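/- For every n ≥ 2, the structure (ℚ, ≤) does not have an n-ary universal homogeneous polymorphism. That is, there is no monotone map u : ℚⁿ → ℚ (with respect to the componentwise order on ℚⁿ) that is simultaneously a universal and a homogeneous polymorphism of (ℚ, ≤). -/

import Mathlib

set_option autoImplicit false

/-! ## Relational signatures and structures -/

structure RelSig where
  symbols : Type
  arity : symbols → ℕ

structure RelStr (σ : RelSig) where
  carrier : Type
  rel : ∀ s : σ.symbols, Set (Fin (σ.arity s) → carrier)

namespace RelStr

variable {σ : RelSig}

/-- Homomorphisms of relational structures. -/
def IsHom (A B : RelStr σ) (h : A.carrier → B.carrier) : Prop :=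
  ∀ (s : σ.symbols) (t : Fin (σ.arity s) → A.carrier),
    t ∈ A.rel s → (fun j => h (t j)) ∈ B.rel s

/-- Embeddings of relational structures. -/
def IsEmb (A B : RelStr σ) (h : A.carrier → B.carrier) : Prop :=
  Function.Injective h ∧
    ∀ (s : σ.symbols) (t : Fin (σ.arity s) → A.carrier),
      t ∈ A.rel s ↔ (fun j => h (t j)) ∈ B.rel s

/-- Automorphisms: surjective self-embeddings. -/
def IsAut (A : RelStr σ) (h : A.carrier → A.carrier) : Prop :=
  Function.Surjective h ∧ IsEmb A A h

/-- The n-th direct power of a relational structure. -/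
def pow (A : RelStr σ) (n : ℕ) : RelStr σ where
  carrier := Fin n → A.carrier
  rel s := {t | ∀ i : Fin n, (fun j => t j i) ∈ A.rel s}

/-- The direct product of two relational structures. -/
def prod (A B : RelStr σ) : RelStr σ where
  carrier := A.carrier × B.carrier
  rel s := {t | (fun j => (t j).1) ∈ A.rel s ∧ (fun j => (t j).2) ∈ B.rel s}

/-- `A.inAge B` : `B` belongs to the age of `A`, i.e. `B` is finite and embeddable into `A`. -/
def inAge (A B : RelStr σ) : Prop :=
  Finite B.carrier ∧ ∃ h : B.carrier → A.carrier, IsEmb B A h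

/-- `Younger A U` : the age of `A` is contained in the age of `U`. -/
def Younger (A U : RelStr σ) : Prop :=
  ∀ B : RelStr σ, inAge A B → inAge U B

/-- Homogeneity: any two embeddings of a member of the age differ by an automorphism. -/
def IsHomogeneous (U : RelStr σ) : Prop :=
  ∀ B : RelStr σ, inAge U B →
    ∀ ι₁ ι₂ : B.carrier → U.carrier, IsEmb B U ι₁ → IsEmb B U ι₂ →
      ∃ h : U.carrier → U.carrier, IsAut U h ∧ ∀ b, h (ι₁ b) = ι₂ b

/-- ω-categoricity of a countable structure, rendered via the
Engeler–Ryll-Nardzewski–Svenonius theorem: the automorphism group is oligomorphic,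
i.e. has finitely many orbits on `n`-tuples for every `n`. -/
def IsOligomorphic (U : RelStr σ) : Prop :=
  ∀ n : ℕ, ∃ (k : ℕ) (reps : Fin k → (Fin n → U.carrier)),
    ∀ t : Fin n → U.carrier, ∃ (j : Fin k) (h : U.carrier → U.carrier),
      IsAut U h ∧ ∀ i, h (reps j i) = t i

/-- The automorphism group acts transitively on the carrier. -/
def AutTransitive (U : RelStr σ) : Prop :=
  ∀ x y : U.carrier, ∃ h : U.carrier → U.carrier, IsAut U h ∧ h x = y

/-- `D` (with embeddings `g₁, g₂`) is the amalgamated free sum of `B₁` and `B₂`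
over `A` (with embeddings `f₁, f₂`): the carriers are glued exactly along `A`, and
every relation of `D` comes from `B₁` or from `B₂`. -/
def IsFreeAmalgam (A B₁ B₂ D : RelStr σ)
    (f₁ : A.carrier → B₁.carrier) (f₂ : A.carrier → B₂.carrier)
    (g₁ : B₁.carrier → D.carrier) (g₂ : B₂.carrier → D.carrier) : Prop :=
  IsEmb B₁ D g₁ ∧ IsEmb B₂ D g₂ ∧ (∀ a, g₁ (f₁ a) = g₂ (f₂ a)) ∧
    (∀ d : D.carrier, (∃ b, g₁ b = d) ∨ (∃ b, g₂ b = d)) ∧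
    (∀ b₁ b₂, g₁ b₁ = g₂ b₂ → ∃ a, f₁ a = b₁ ∧ f₂ a = b₂) ∧
    ∀ (s : σ.symbols) (t : Fin (σ.arity s) → D.carrier), t ∈ D.rel s →
      (∃ t' ∈ B₁.rel s, ∀ j, g₁ (t' j) = t j) ∨ (∃ t' ∈ B₂.rel s, ∀ j, g₂ (t' j) = t j)

/-- The age of `U` has the free amalgamation property. -/
def AgeFAP (U : RelStr σ) : Prop :=
  ∀ A B₁ B₂ : RelStr σ, inAge U A → inAge U B₁ → inAge U B₂ →
    ∀ (f₁ : A.carrier → B₁.carrier) (f₂ : A.carrier → B₂.carrier),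
      IsEmb A B₁ f₁ → IsEmb A B₂ f₂ →
      ∃ (D : RelStr σ) (g₁ : B₁.carrier → D.carrier) (g₂ : B₂.carrier → D.carrier),
        inAge U D ∧ IsFreeAmalgam A B₁ B₂ D f₁ f₂ g₁ g₂

/-- The age of `U` is closed with respect to finite products. -/
def AgeClosedUnderProducts (U : RelStr σ) : Prop :=
  ∀ A B : RelStr σ, inAge U A → inAge U B → inAge U (A.prod B)

/-- The age of `U` has the homo-amalgamation property (HAP). -/
def AgeHAP (U : RelStr σ) : Prop :=
  ∀ A B C : RelStr σ, inAge U A → inAge U B → inAge U C →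
    ∀ (f : A.carrier → B.carrier) (g : A.carrier → C.carrier),
      IsHom A B f → IsEmb A C g →
      ∃ (D : RelStr σ) (f' : C.carrier → D.carrier) (g' : B.carrier → D.carrier),
        inAge U D ∧ IsHom C D f' ∧ IsEmb B D g' ∧ ∀ a, f' (g a) = g' (f a)

end RelStr

open RelStr

/-! ## Primitive positive formulas -/

/-- Primitive positive formulas with `n` free variables. -/
inductive PP (σ : RelSig) : ℕ → Type
  | eq : ∀ {n : ℕ}, Fin n → Fin n → PP σ n
  | rel : ∀ {n : ℕ} (s : σ.symbols), (Fin (σ.arity s) → Fin n) → PP σ n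
  | and : ∀ {n : ℕ}, PP σ n → PP σ n → PP σ n
  | ex : ∀ {n : ℕ}, PP σ (n + 1) → PP σ n

/-- Satisfaction of a primitive positive formula. -/
def PP.Sat {σ : RelSig} (U : RelStr σ) : ∀ {n : ℕ}, PP σ n → (Fin n → U.carrier) → Prop
  | _, .eq i j, t => t i = t j
  | _, .rel s v, t => (fun k => t (v k)) ∈ U.rel s
  | _, .and φ ψ, t => PP.Sat U φ t ∧ PP.Sat U ψ t
  | _, .ex φ, t => ∃ a : U.carrier, PP.Sat U φ (Fin.snoc t a)

/-- Quantifier-free primitive positive formulas. -/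
def PP.QFree {σ : RelSig} : ∀ {n : ℕ}, PP σ n → Prop
  | _, .eq _ _ => True
  | _, .rel _ _ => True
  | _, .and φ ψ => PP.QFree φ ∧ PP.QFree ψ
  | _, .ex _ => False

/-- `U` has quantifier elimination for primitive positive formulas. -/
def HasPPQE {σ : RelSig} (U : RelStr σ) : Prop :=
  ∀ (n : ℕ) (φ : PP σ n), ∃ ψ : PP σ n, PP.QFree ψ ∧
    ∀ t : Fin n → U.carrier, PP.Sat U φ t ↔ PP.Sat U ψ t

/-! ## Polymorphisms -/

/-- An `n`-ary polymorphism of `U`: a homomorphism `Uⁿ → U`. -/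
def IsPolymorphism {σ : RelSig} (U : RelStr σ) (n : ℕ)
    (u : (Fin n → U.carrier) → U.carrier) : Prop :=
  IsHom (U.pow n) U u

/-- Universal `n`-ary polymorphism. -/
def IsUniversalPolymorphism {σ : RelSig} (U : RelStr σ) (n : ℕ)
    (u : (Fin n → U.carrier) → U.carrier) : Prop :=
  IsPolymorphism U n u ∧
    ∀ A : RelStr σ, Countable A.carrier → Younger A U →
      ∀ f : (Fin n → A.carrier) → U.carrier, IsHom (A.pow n) U f →
        ∃ ι : A.carrier → U.carrier, IsEmb A U ι ∧
          ∀ t : Fin n → A.carrier, f t = u (fun i => ι (t i))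

/-- Homogeneous `n`-ary polymorphism. -/
def IsHomogeneousPolymorphism {σ : RelSig} (U : RelStr σ) (n : ℕ)
    (u : (Fin n → U.carrier) → U.carrier) : Prop :=
  IsPolymorphism U n u ∧
    ∀ A : RelStr σ, inAge U A →
      ∀ f : (Fin n → A.carrier) → U.carrier, IsHom (A.pow n) U f →
        ∀ ι₁ ι₂ : A.carrier → U.carrier, IsEmb A U ι₁ → IsEmb A U ι₂ →
          (∀ t : Fin n → A.carrier, u (fun i => ι₁ (t i)) = f t) →
          (∀ t : Fin n → A.carrier, u (fun i => ι₂ (t i)) = f t) →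
          ∃ h : U.carrier → U.carrier, IsAut U h ∧ (∀ a, h (ι₁ a) = ι₂ a) ∧
            ∀ t : Fin n → U.carrier, u (fun i => h (t i)) = u t

/-! ## Clones of finitary operations

Operations of arity `n + 1` are indexed by `n : ℕ`, so that all arities are `≥ 1`. -/

structure Clone (U : Type) where
  ops : ∀ n : ℕ, Set ((Fin (n + 1) → U) → U)
  proj_mem : ∀ (n : ℕ) (i : Fin (n + 1)), (fun x => x i) ∈ ops n
  comp_mem : ∀ {n m : ℕ} (f : (Fin (n + 1) → U) → U) (g : Fin (n + 1) → (Fin (m + 1) → U) → U),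
      f ∈ ops n → (∀ i, g i ∈ ops m) → (fun x => f fun i => g i x) ∈ ops m

/-- The underlying set of a clone: the disjoint sum of its arity fibers. -/
abbrev Clone.Elem {U : Type} (C : Clone U) : Type := Σ n : ℕ, ↥(C.ops n)

/-- The polymorphism clone of a relational structure. -/
def polClone {σ : RelSig} (U : RelStr σ) : Clone U.carrier where
  ops n := {f | IsPolymorphism U (n + 1) f}
  proj_mem n i := fun s t ht => ht i
  comp_mem f g hf hg := fun s t ht => hf s (fun j i => g i (t j)) (fun i => hg i s t ht)

/-- The topology of pointwise convergence (the carrier being discrete) on the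
space of `n+1`-ary operations on `U`. -/
def fnTop (U : Type) (n : ℕ) : TopologicalSpace ((Fin (n + 1) → U) → U) :=
  letI : TopologicalSpace U := ⊥
  inferInstance

/-- The topology of pointwise convergence on an arity fiber of a clone. -/
def opsTop {U : Type} (C : Clone U) (n : ℕ) : TopologicalSpace ↥(C.ops n) :=
  letI : TopologicalSpace U := ⊥
  inferInstance

/-- The canonical topology on a clone: the sum over all arities of the topologies
of pointwise convergence. -/
def cloneTop {U : Type} (C : Clone U) : TopologicalSpace C.Elem :=
  letI : TopologicalSpace U := ⊥
  inferInstance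

/-- Clone homomorphisms: arity preserving maps preserving projections and composition. -/
structure CloneHom {U V : Type} (C : Clone U) (D : Clone V) where
  app : ∀ n : ℕ, ↥(C.ops n) → ↥(D.ops n)
  map_proj : ∀ (n : ℕ) (i : Fin (n + 1)),
    (app n ⟨fun x => x i, C.proj_mem n i⟩).val = fun x => x i
  map_comp : ∀ (n m : ℕ) (f : ↥(C.ops n)) (g : Fin (n + 1) → ↥(C.ops m)),
    (app m ⟨fun x => f.val fun i => (g i).val x,
        C.comp_mem f.val (fun i => (g i).val) f.property (fun i => (g i).property)⟩).val
      = fun x => (app n f).val fun i => (app m (g i)).val x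

/-- The action of a clone homomorphism on the underlying sets. -/
def CloneHom.elemMap {U V : Type} {C : Clone U} {D : Clone V} (h : CloneHom C D) :
    C.Elem → D.Elem :=
  fun p => ⟨p.1, h.app p.1 p.2⟩

/-- Application of a unary operation (in the `Fin 1` encoding) to a point. -/
def ap1 {U : Type} (φ : (Fin 1 → U) → U) (u : U) : U := φ (fun _ => u)

/-- The group of units of the unary part of a clone. -/
def cloneUnits {U : Type} (C : Clone U) : Set ((Fin 1 → U) → U) :=
  {φ | φ ∈ C.ops 0 ∧ ∃ ψ ∈ C.ops 0, (∀ u, ap1 φ (ap1 ψ u) = u) ∧ ∀ u, ap1 ψ (ap1 φ u) = u}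

/-- The closure of the group of units inside the unary part of a clone. -/
def unitClosure {U : Type} (C : Clone U) : Set ((Fin 1 → U) → U) :=
  C.ops 0 ∩ @closure _ (fnTop U 0) (cloneUnits C)

/-- Cauchy sequences of functions with respect to the complete ultrametric of
pointwise convergence (discrete codomain): at every argument, the sequence of
values is eventually constant. -/
def PtwCauchy {α U : Type} (g : ℕ → α → U) : Prop :=
  ∀ x : α, ∃ N : ℕ, ∀ m, N ≤ m → ∀ m', N ≤ m' → g m x = g m' x

/-- Pointwise convergence of a sequence of functions (discrete codomain). -/
def PtwConv {α β : Type} (g : ℕ → α → β) (f : α → β) : Prop :=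
  ∀ x : α, ∃ N : ℕ, ∀ j, N ≤ j → g j x = f x

/-- A strong gate covering of a clone. -/
def StrongGateCovering {U : Type} (C : Clone U) : Prop :=
  ∃ (𝒰 : Set (Set C.Elem)) (F : ∀ V ∈ 𝒰, C.Elem),
    (∀ V ∈ 𝒰, @IsOpen _ (cloneTop C) V) ∧
    (∀ p : C.Elem, ∃ V ∈ 𝒰, p ∈ V) ∧
    (∀ V (hV : V ∈ 𝒰), F V hV ∈ V) ∧
    ∀ V (hV : V ∈ 𝒰) (k : ℕ) (g : ℕ → ↥(C.ops k)),
      (∀ j : ℕ, (⟨k, g j⟩ : C.Elem) ∈ V) →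
      PtwCauchy (fun j => (g j).val) →
      ∃ fV : ↥(C.ops k), F V hV = ⟨k, fV⟩ ∧
        ∃ (κ : ℕ → (Fin 1 → U) → U) (ι : Fin (k + 1) → ℕ → (Fin 1 → U) → U),
          (∀ j, κ j ∈ unitClosure C) ∧ (∀ i j, ι i j ∈ unitClosure C) ∧
          PtwCauchy κ ∧ (∀ i, PtwCauchy (ι i)) ∧
          ∀ (j : ℕ) (x : Fin (k + 1) → U),
            (g j).val x = ap1 (κ j) (fV.val fun i => ap1 (ι i j) (x i))

/-- A closed (sub)clone of the clone of all operations. -/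
def IsClosedClone {U : Type} (C : Clone U) : Prop :=
  ∀ n : ℕ, @IsClosed _ (fnTop U n) (C.ops n)

/-! ## Posets as relational structures -/

/-- The signature with a single binary relation symbol. -/
def sigOrd : RelSig := ⟨Unit, fun _ => 2⟩

/-- A (reflexive) partial order viewed as a relational structure. -/
def ordStruc (P : Type) [PartialOrder P] : RelStr sigOrd where
  carrier := P
  rel _ := {t : Fin 2 → P | t 0 ≤ t 1}

/-! ## The amalgamation extension property AEPⁿ and the homo-amalgamation property HAPⁿ -/

/-- A class `𝒞` of relational structures has the AEPⁿ. -/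
def HasAEPn {σ : RelSig} (𝒞 : RelStr σ → Prop) (n : ℕ) : Prop :=
  ∀ A B₁ B₂ T : RelStr σ, 𝒞 A → 𝒞 B₁ → 𝒞 B₂ → 𝒞 T →
    ∀ (f₁ : A.carrier → B₁.carrier) (f₂ : A.carrier → B₂.carrier),
      RelStr.IsEmb A B₁ f₁ → RelStr.IsEmb A B₂ f₂ →
      ∀ (h₁ : (Fin n → B₁.carrier) → T.carrier) (h₂ : (Fin n → B₂.carrier) → T.carrier),
        RelStr.IsHom (B₁.pow n) T h₁ → RelStr.IsHom (B₂.pow n) T h₂ →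
        (∀ t : Fin n → A.carrier, h₁ (fun i => f₁ (t i)) = h₂ (fun i => f₂ (t i))) →
        ∃ (C T' : RelStr σ) (g₁ : B₁.carrier → C.carrier) (g₂ : B₂.carrier → C.carrier)
            (k : T.carrier → T'.carrier) (h : (Fin n → C.carrier) → T'.carrier),
          𝒞 C ∧ 𝒞 T' ∧ RelStr.IsEmb B₁ C g₁ ∧ RelStr.IsEmb B₂ C g₂ ∧
            (∀ a, g₁ (f₁ a) = g₂ (f₂ a)) ∧ RelStr.IsEmb T T' k ∧
            RelStr.IsHom (C.pow n) T' h ∧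
            (∀ t : Fin n → B₁.carrier, h (fun i => g₁ (t i)) = k (h₁ t)) ∧
            (∀ t : Fin n → B₂.carrier, h (fun i => g₂ (t i)) = k (h₂ t))

/-- A class `𝒞` of relational structures has the HAPⁿ. -/
def HasHAPn {σ : RelSig} (𝒞 : RelStr σ → Prop) (n : ℕ) : Prop :=
  ∀ A B T₁ : RelStr σ, 𝒞 A → 𝒞 B → 𝒞 T₁ →
    ∀ (g : A.carrier → B.carrier) (a : (Fin n → A.carrier) → T₁.carrier),
      RelStr.IsEmb A B g → RelStr.IsHom (A.pow n) T₁ a →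
      ∃ (T₂ : RelStr σ) (h : T₁.carrier → T₂.carrier) (b : (Fin n → B.carrier) → T₂.carrier),
        𝒞 T₂ ∧ RelStr.IsEmb T₁ T₂ h ∧ RelStr.IsHom (B.pow n) T₂ b ∧
          ∀ t : Fin n → A.carrier, b (fun i => g (t i)) = h (a t)

/-- Polymorphisms of `(ℚ, ≤)` are monotone. -/
theorem monotone_of_isPolymorphism {n : ℕ} {u : (Fin n → ℚ) → ℚ}
    (hu : IsPolymorphism (ordStruc ℚ) n u) : Monotone u :=
  fun x y hxy => hu () (fun j : Fin 2 => if j = 0 then x else y) hxy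

/-- Every coordinate projection factors through a universal polymorphism of `(ℚ, ≤)`. -/
theorem exists_emb_apply_eq_proj {n : ℕ} {u : (Fin n → ℚ) → ℚ}
    (hu : IsUniversalPolymorphism (ordStruc ℚ) n u) (i : Fin n) :
    ∃ ι : ℚ → ℚ, ∀ t : Fin n → ℚ, u (fun k => ι (t k)) = t i := by
  obtain ⟨ι, -, hι⟩ := hu.2 (ordStruc ℚ) (inferInstanceAs (Countable ℚ)) (fun _ h => h)
    (fun t => t i) (fun _ _ ht => ht i)
  exact ⟨ι, fun t => (hι t).symm⟩

/-- A homogeneous polymorphism `u` of `(ℚ, ≤)` is preserved by a self-map of `ℚ` carrying one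
given point to another, provided `u` takes equal values on the corresponding diagonal elements. -/
theorem exists_map_eq_of_diag_eq {n : ℕ} {u : (Fin n → ℚ) → ℚ}
    (hu : IsHomogeneousPolymorphism (ordStruc ℚ) n u) {x y : ℚ}
    (hxy : u (fun _ => x) = u (fun _ => y)) :
    ∃ h : ℚ → ℚ, h x = y ∧ ∀ t : Fin n → ℚ, u (fun k => h (t k)) = u t := by
  have emb (z : ℚ) : IsEmb (ordStruc Unit) (ordStruc ℚ) (fun _ => z) :=
    ⟨fun _ _ _ => rfl, fun _ _ => iff_of_true (le_refl ()) (le_refl z)⟩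
  obtain ⟨h, -, hh, hinv⟩ := hu.2 (ordStruc Unit)
    ⟨inferInstanceAs (Finite Unit), _, emb x⟩ (fun _ => u fun _ => x)
    (fun _ _ _ => le_refl (u fun _ => x)) _ _ (emb x) (emb y) (fun _ => rfl) (fun _ => hxy.symm)
  exact ⟨h, hh (), hinv⟩

/-- For every `n ≥ 2`, the structure `(ℚ, ≤)` does not have an `n`-ary
universal homogeneous polymorphism. -/
theorem stmt_17 (n : ℕ) (hn : 2 ≤ n) :
    ¬ ∃ u : (Fin n → ℚ) → ℚ,
        IsUniversalPolymorphism (ordStruc ℚ) n u ∧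
        IsHomogeneousPolymorphism (ordStruc ℚ) n u := by
  rintro ⟨u, huniv, hhom⟩
  have hmono := monotone_of_isPolymorphism huniv.1
  let i : Fin n := ⟨0, by omega⟩
  let j : Fin n := ⟨1, by omega⟩
  have hij : i ≠ j := by simp [i, j]
  obtain ⟨ι, hι⟩ := exists_emb_apply_eq_proj huniv i
  obtain ⟨κ, hκ⟩ := exists_emb_apply_eq_proj huniv j
  obtain ⟨h, h0, hinv⟩ := exists_map_eq_of_diag_eq hhom
    ((hι fun _ => 0).trans (hκ fun _ => 0).symm)
  -- `e k` is the `k`-th standard basis vector.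
  let e (k : Fin n) : Fin n → ℚ := fun l => if l = k then 1 else 0
  have hιe (k : Fin n) : u (fun l => h (ι (e k l))) = e k i :=
    (hinv fun l => ι (e k l)).trans (hι (e k))
  rcases le_total (h (ι 1)) (κ 1) with hle | hle
  · have key : u (fun l => h (ι (e i l))) ≤ u (fun l => κ (e i l)) := hmono fun l => by
      by_cases hl : l = i <;> simp [e, hl, hle, h0]
    rw [hιe, hκ] at key
    norm_num [e, hij.symm] at key
  · have key : u (fun l => κ (e j l)) ≤ u (fun l => h (ι (e j l))) := hmono fun l => by
      by_cases hl : l = j <;> simp [e, hl, hle, h0]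
    rw [hιe, hκ] at key
    norm_num [e, hij] at key
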